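/- For every r×n G-pattern matrix P (with r ≤ n), the number of entries of P equal to * is at most r·n − r(r+1)/2; in particular it is at most r·(n − r/2). -/

import Mathlib

/-- The three symbols of a G-pattern: `zero`, `one`, and `star`. -/
inductive GSymbol : Type
  | zero : GSymbol
  | one : GSymbol
  | star : GSymbol
deriving DecidableEq

/-- A G-pattern: an `r×n` matrix with entries in `{0,1,*}` such that
(1) every column contains at most one `1`, and a column containing a `1` contains no `*`;
(2) in every row, the leftmost entry different from `0` is a `1`, and every row contains
at most one `1`;
(3) every row containing a `1` has smaller index than every all-zero row. -/
def IsGPattern {r n : ℕ} (P : Matrix (Fin r) (Fin n) GSymbol) : Prop :=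
  (∀ ℓ : Fin n,
      ({j : Fin r | P j ℓ = GSymbol.one} : Set (Fin r)).Subsingleton ∧
      ((∃ j, P j ℓ = GSymbol.one) → ∀ j, P j ℓ ≠ GSymbol.star)) ∧
  (∀ j : Fin r,
      (∀ ℓ : Fin n, P j ℓ ≠ GSymbol.zero →
        (∀ ℓ' : Fin n, ℓ' < ℓ → P j ℓ' = GSymbol.zero) → P j ℓ = GSymbol.one) ∧
      ({ℓ : Fin n | P j ℓ = GSymbol.one} : Set (Fin n)).Subsingleton) ∧
  (∀ j j' : Fin r, (∃ ℓ, P j ℓ = GSymbol.one) →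
      (∀ ℓ, P j' ℓ = GSymbol.zero) → j < j')

/-- A matrix `Y` has G-pattern `P` if `Y` vanishes where `P` is `0` and equals `1`
where `P` is `1` (entries at `*` positions are unrestricted). -/
def HasGPattern {𝔽 : Type*} [Field 𝔽] {r n : ℕ}
    (Y : Matrix (Fin r) (Fin n) 𝔽) (P : Matrix (Fin r) (Fin n) GSymbol) : Prop :=
  ∀ j ℓ, (P j ℓ = GSymbol.zero → Y j ℓ = 0) ∧ (P j ℓ = GSymbol.one → Y j ℓ = 1)

/-- In a G-pattern, a row with an entry different from `0` contains a `1`. -/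
lemma IsGPattern.exists_one_of_ne_zero {r n : ℕ} {P : Matrix (Fin r) (Fin n) GSymbol}
    (hP : IsGPattern P) {j : Fin r} {ℓ : Fin n} (h : P j ℓ ≠ GSymbol.zero) :
    ∃ ℓ', P j ℓ' = GSymbol.one := by
  induction ℓ using WellFoundedLT.induction with
  | ind ℓ ih =>
    by_cases h_left : ∀ ℓ' < ℓ, P j ℓ' = GSymbol.zero
    · exact ⟨ℓ, (hP.2.1 j).1 ℓ h h_left⟩
    · push Not at h_left
      obtain ⟨ℓ', hlt, hne⟩ := h_left
      exact ih ℓ' hlt hne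

/-- The `*` entries of a G-pattern with `m` nonzero rows lie in these rows and in the `n - m`
columns without a `1`. -/
lemma IsGPattern.exists_card_star_le {r n : ℕ} {P : Matrix (Fin r) (Fin n) GSymbol}
    (hP : IsGPattern P) :
    ∃ m ≤ r, Nat.card {q : Fin r × Fin n // P q.1 q.2 = GSymbol.star} ≤ m * (n - m) := by
  classical
  let S : Finset (Fin r) := {j | ∃ ℓ, P j ℓ = GSymbol.one}
  let T : Finset (Fin n) := {ℓ | ∃ j, P j ℓ = GSymbol.one}
  have hST : S.card ≤ T.card := by
    refine Finset.card_le_card_of_forall_subsingleton (fun j ℓ => P j ℓ = GSymbol.one) ?_ ?_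
    · intro j hj
      obtain ⟨ℓ, hℓ⟩ := (Finset.mem_filter.mp hj).2
      exact ⟨ℓ, by simpa [T] using ⟨j, hℓ⟩, hℓ⟩
    · exact fun ℓ _ j hj j' hj' => (hP.1 ℓ).1 hj.2 hj'.2
  refine ⟨S.card, by simpa using S.card_le_univ, ?_⟩
  rw [Nat.card_eq_fintype_card, Fintype.card_subtype]
  calc (Finset.univ.filter fun q : Fin r × Fin n => P q.1 q.2 = GSymbol.star).card
      ≤ (S ×ˢ Tᶜ).card := by
        refine Finset.card_le_card fun q hq => ?_
        have h_star : P q.1 q.2 = GSymbol.star := by simpa using hq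
        have h_row := hP.exists_one_of_ne_zero (j := q.1) (ℓ := q.2) (by simp [h_star])
        have h_col : ¬∃ j, P j q.2 = GSymbol.one := fun h => (hP.1 q.2).2 h q.1 h_star
        rw [Finset.mem_product, Finset.mem_compl]
        exact ⟨by simpa [S] using h_row, by simpa [T] using h_col⟩
    _ = S.card * (n - T.card) := by
        rw [Finset.card_product, Finset.card_compl, Fintype.card_fin]
    _ ≤ S.card * (n - S.card) := Nat.mul_le_mul_left _ (Nat.sub_le_sub_left hST n)

/-- The number `m (n - m)` is at most `rn - r(r+1)/2` for natural numbers `m ≤ r ≤ n`. -/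
lemma cast_mul_sub_le_mul_sub_triangle {m r n : ℕ} (hmr : m ≤ r) (hrn : r ≤ n) :
    ((m * (n - m) : ℕ) : ℝ) ≤ (r : ℝ) * n - r * (r + 1) / 2 := by
  obtain ⟨a, rfl⟩ := Nat.exists_eq_add_of_le hmr
  obtain ⟨b, rfl⟩ := Nat.exists_eq_add_of_le hrn
  have hm : (m : ℝ) ≤ m * m := by exact_mod_cast Nat.le_mul_self m
  have ha : (a : ℝ) ≤ a * a := by exact_mod_cast Nat.le_mul_self a
  have hab : (0 : ℝ) ≤ a * b := by positivity
  rw [show m + a + b - m = a + b by omega]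
  push_cast
  linarith

/-- Lemma 10: an `r×n` G-pattern (`r ≤ n`) has at most `rn − r(r+1)/2 ≤ r(n − r/2)`
entries equal to `*`. -/
theorem GPattern_star_count_le
    (r n : ℕ) (hrn : r ≤ n) (P : Matrix (Fin r) (Fin n) GSymbol)
    (hP : IsGPattern P) :
    (Nat.card {q : Fin r × Fin n // P q.1 q.2 = GSymbol.star} : ℝ)
        ≤ (r : ℝ) * n - r * (r + 1) / 2 ∧
    (Nat.card {q : Fin r × Fin n // P q.1 q.2 = GSymbol.star} : ℝ)
        ≤ (r : ℝ) * ((n : ℝ) - r / 2) := by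
  obtain ⟨m, hmr, hm⟩ := hP.exists_card_star_le
  have h := (Nat.cast_le (α := ℝ).mpr hm).trans (cast_mul_sub_le_mul_sub_triangle hmr hrn)
  have hr : (0 : ℝ) ≤ r := r.cast_nonneg
  exact ⟨h, by linarith⟩
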